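/- The moment map f : C₊(𝕋) × L₊^Γ → range₊Γ, f(ψ,Λ) = ∫ G ψ (G*ΛG)^{-1} G* dθ/(2π), is continuously (Fréchet) differentiable, with partial derivatives f'_1(ψ,Λ)(δψ) = ∫ G δψ (G*ΛG)^{-1} G* and f'_2(ψ,Λ)(δΛ) = −∫ G ψ (G*ΛG)^{-1}(G* δΛ G)(G*ΛG)^{-1} G*. -/

import Mathlib

open Real
open scoped Matrix ComplexOrder

attribute [local instance] Matrix.frobeniusSeminormedAddCommGroup
  Matrix.frobeniusNormedAddCommGroup Matrix.frobeniusNormedSpace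

/-- The moment map `f(ψ,Λ) = ∫ G ψ (G*ΛG)⁻¹ G* dθ/(2π)`. -/
noncomputable def momentMap {n m : ℕ} (G : C(Circle, Matrix (Fin n) (Fin m) ℂ))
    (p : C(Circle, ℝ) × Matrix (Fin n) (Fin n) ℂ) : Matrix (Fin n) (Fin n) ℂ :=
  (2 * π)⁻¹ • ∫ θ in (-π)..π,
    p.1 (Circle.exp θ) •
      (G (Circle.exp θ) * ((G (Circle.exp θ))ᴴ * p.2 * G (Circle.exp θ))⁻¹ * (G (Circle.exp θ))ᴴ)

theorem abs_aux {X V A W : Type*} [NormedAddCommGroup X] [NormedSpace ℝ X]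
    [NormedAddCommGroup V] [NormedSpace ℝ V] [NormedRing A] [NormedAlgebra ℝ A] [CompleteSpace A]
    [NormedAddCommGroup W] [NormedSpace ℝ W]
    (E : X →L[ℝ] A) (Φ : V →L[ℝ] A) (L : A →L[ℝ] W) (f : X × V → W)
    (hf : ∀ p : X × V, IsUnit (Φ p.2) → f p = L (E p.1 * Ring.inverse (Φ p.2)))
    (D : Set (X × V)) (hD : ∀ p ∈ D, IsUnit (Φ p.2)) :
    ∃ Df : X × V → (X × V →L[ℝ] W), ContinuousOn Df D ∧ ∀ p ∈ D, HasFDerivAt f (Df p) p ∧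
      ∀ (a : X) (b : V), Df p (a, b) = L (E a * Ring.inverse (Φ p.2)
        - E p.1 * (Ring.inverse (Φ p.2) * Φ b * Ring.inverse (Φ p.2))) := by
  have hev : ∀ p ∈ D, f =ᶠ[nhds p] fun p => L (E p.1 * Ring.inverse (Φ p.2)) := by
    intro p hp
    have hc : ContinuousAt (fun q : X × V => Φ q.2) p := by fun_prop
    have := hc.preimage_mem_nhds (Units.isOpen.mem_nhds (hD p hp))
    filter_upwards [this] with q hq
    exact hf q hq
  have hder : ∀ p ∈ D, ∃ f' : X × V →L[ℝ] W, HasFDerivAt f f' p ∧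
      ∀ (a : X) (b : V), f' (a, b) = L (E a * Ring.inverse (Φ p.2)
        - E p.1 * (Ring.inverse (Φ p.2) * Φ b * Ring.inverse (Φ p.2))) := by
    intro p hp
    obtain ⟨u, hu⟩ := hD p hp
    have h1 : HasFDerivAt (fun q : X × V => E q.1) (E.comp (ContinuousLinearMap.fst ℝ X V)) p :=
      (E.comp (ContinuousLinearMap.fst ℝ X V)).hasFDerivAt
    have h2 : HasFDerivAt (fun q : X × V => Φ q.2) (Φ.comp (ContinuousLinearMap.snd ℝ X V)) p :=
      (Φ.comp (ContinuousLinearMap.snd ℝ X V)).hasFDerivAt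
    have h3 := hasFDerivAt_ringInverse (𝕜 := ℝ) u
    rw [hu] at h3
    have h4 := h3.comp p h2
    have h5 := L.hasFDerivAt.comp p (h1.mul' h4)
    refine ⟨_, h5.congr_of_eventuallyEq (hev p hp), ?_⟩
    intro a b
    simp [← hu, sub_eq_add_neg, add_comm]
  refine ⟨fderiv ℝ f, ?_, ?_⟩
  · intro p hp
    obtain ⟨u, hu⟩ := hD p hp
    have h1 : ContDiffAt ℝ 1 (fun q : X × V => E q.1) p := by fun_prop
    have h2 : ContDiffAt ℝ 1 (fun q : X × V => Φ q.2) p := by fun_prop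
    have h3 := contDiffAt_ringInverse ℝ (n := 1) u
    rw [hu] at h3
    have h4 := h3.comp p h2
    have h5 : ContDiffAt ℝ 1 f p :=
      (L.contDiff.contDiffAt.comp p (h1.mul h4)).congr_of_eventuallyEq (hev p hp)
    exact (h5.continuousAt_fderiv (by simp)).continuousWithinAt
  · intro p hp
    obtain ⟨f', h, h'⟩ := hder p hp
    rw [h.fderiv]
    exact ⟨h, h'⟩

section
attribute [local instance] Matrix.frobeniusNormedRing Matrix.frobeniusNormedAlgebra

theorem invC_apply {m : ℕ} (F : C(Circle, Matrix (Fin m) (Fin m) ℂ)) (hF : IsUnit F) (z : Circle) :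
    (Ring.inverse F) z = (F z)⁻¹ := by
  obtain ⟨u, rfl⟩ := hF
  rw [Ring.inverse_unit]
  symm
  apply Matrix.inv_eq_right_inv
  rw [← ContinuousMap.mul_apply, Units.mul_inv]; rfl

theorem isUnit_of {m : ℕ} (F : C(Circle, Matrix (Fin m) (Fin m) ℂ)) (hF : ∀ z, IsUnit (F z)) :
    IsUnit F := by
  refine (ContinuousMap.isUnit_iff_forall_isUnit (f := F)).2 ?_
  exact hF

noncomputable def Emap (m : ℕ) : C(Circle, ℝ) →L[ℝ] C(Circle, Matrix (Fin m) (Fin m) ℂ) where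
  toFun ψ := ⟨fun z => ψ z • (1 : Matrix (Fin m) (Fin m) ℂ), by fun_prop⟩
  map_add' a b := by ext1 z; simp [add_smul]
  map_smul' a b := by ext1 z; simp [mul_smul]
  cont := by
    apply ContinuousMap.continuous_of_continuous_uncurry
    simp only [Function.uncurry_def, ContinuousMap.coe_mk]
    fun_prop

noncomputable def Phimap {n m : ℕ} (G : C(Circle, Matrix (Fin n) (Fin m) ℂ)) :
    Matrix (Fin n) (Fin n) ℂ →L[ℝ] C(Circle, Matrix (Fin m) (Fin m) ℂ) where
  toFun Λ := ⟨fun z => (G z)ᴴ * Λ * G z, by fun_prop⟩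
  map_add' a b := by ext1 z; simp [Matrix.mul_add, Matrix.add_mul]
  map_smul' a b := by ext1 z; simp
  cont := by
    apply ContinuousMap.continuous_of_continuous_uncurry
    simp only [Function.uncurry_def, ContinuousMap.coe_mk]
    fun_prop

noncomputable def Lmap {n m : ℕ} (G : C(Circle, Matrix (Fin n) (Fin m) ℂ)) :
    C(Circle, Matrix (Fin m) (Fin m) ℂ) →L[ℝ] Matrix (Fin n) (Fin n) ℂ where
  toFun F := (2 * π)⁻¹ • ∫ θ in (-π)..π,
    G (Circle.exp θ) * F (Circle.exp θ) * (G (Circle.exp θ))ᴴ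
  map_add' a b := by
    rw [← smul_add, ← intervalIntegral.integral_add]
    · simp [Matrix.mul_add, Matrix.add_mul]
    · exact Continuous.intervalIntegrable (by fun_prop) _ _
    · exact Continuous.intervalIntegrable (by fun_prop) _ _
  map_smul' a b := by
    simp only [ContinuousMap.smul_apply, Matrix.mul_smul, Matrix.smul_mul,
      intervalIntegral.integral_smul, RingHom.id_apply]
    rw [smul_comm]
  cont := by
    refine (continuous_const_smul ((2 * π)⁻¹ : ℝ)).comp ?_
    apply intervalIntegral.continuous_parametric_intervalIntegral_of_continuous'
    simp only [Function.uncurry_def]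
    fun_prop

theorem main_aux (n m : ℕ) (G : C(Circle, Matrix (Fin n) (Fin m) ℂ))
    (D : Set (C(Circle, ℝ) × Matrix (Fin n) (Fin n) ℂ))
    (hD : ∀ p ∈ D, IsUnit (Phimap G p.2)) :
    ∃ Df : C(Circle, ℝ) × Matrix (Fin n) (Fin n) ℂ →
        (C(Circle, ℝ) × Matrix (Fin n) (Fin n) ℂ →L[ℝ] Matrix (Fin n) (Fin n) ℂ),
      ContinuousOn Df D ∧
      ∀ p ∈ D, HasFDerivAt (momentMap G) (Df p) p ∧
      ∀ (a : C(Circle, ℝ)) (b : Matrix (Fin n) (Fin n) ℂ), Df p (a, b) =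
        Lmap G (Emap m a * Ring.inverse (Phimap G p.2)
        - Emap m p.1 * (Ring.inverse (Phimap G p.2) * Phimap G b * Ring.inverse (Phimap G p.2))) :=
by
  have hf : ∀ p : C(Circle, ℝ) × Matrix (Fin n) (Fin n) ℂ, IsUnit (Phimap G p.2) →
      momentMap G p = Lmap G (Emap m p.1 * Ring.inverse (Phimap G p.2)) := by
    intro p hp
    simp only [Lmap, momentMap, ContinuousLinearMap.coe_mk', LinearMap.coe_mk, AddHom.coe_mk,
      ContinuousMap.mul_apply, invC_apply _ hp]
    simp [Emap, Phimap]
  let R : NormedRing (Matrix (Fin m) (Fin m) ℂ) := Matrix.frobeniusNormedRing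
  let i1 : NormedRing C(Circle, Matrix (Fin m) (Fin m) ℂ) :=
    @ContinuousMap.instNormedRing Circle _ _ (Matrix (Fin m) (Fin m) ℂ) R
  let i2 : NormedAlgebra ℝ C(Circle, Matrix (Fin m) (Fin m) ℂ) :=
    @ContinuousMap.instNormedAlgebra Circle _ _ ℝ (Matrix (Fin m) (Fin m) ℂ) _
      R.toSeminormedRing Matrix.frobeniusNormedAlgebra
  have hc : @CompleteSpace (Matrix (Fin m) (Fin m) ℂ) R.toMetricSpace.toUniformSpace :=
    FiniteDimensional.complete ℂ (Matrix (Fin m) (Fin m) ℂ)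
  have i3 : @CompleteSpace C(Circle, Matrix (Fin m) (Fin m) ℂ) i1.toMetricSpace.toUniformSpace :=
    @ContinuousMap.instCompleteSpaceOfCompactlyCoherentSpace Circle (Matrix (Fin m) (Fin m) ℂ) _
      R.toMetricSpace.toUniformSpace hc _
  exact abs_aux (X := C(Circle, ℝ)) (V := Matrix (Fin n) (Fin n) ℂ)
    (A := C(Circle, Matrix (Fin m) (Fin m) ℂ)) (W := Matrix (Fin n) (Fin n) ℂ)
    (Emap m) (Phimap G) (Lmap G) (momentMap G) hf D hD
end

/-- The moment map `f(ψ,Λ) = ∫ G ψ (G*ΛG)⁻¹ G*` is continuously Fréchet differentiable on its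
domain `D = C₊(𝕋) × L₊`, with partial derivatives
`f'_1(ψ,Λ)(δψ) = ∫ G δψ (G*ΛG)⁻¹ G*` and
`f'_2(ψ,Λ)(δΛ) = −∫ G ψ (G*ΛG)⁻¹ (G* δΛ G) (G*ΛG)⁻¹ G*`. -/
theorem stmt_13 (n m : ℕ) (G : C(Circle, Matrix (Fin n) (Fin m) ℂ))
    (D : Set (C(Circle, ℝ) × Matrix (Fin n) (Fin n) ℂ))
    (hD : D = {p | (∀ z, 0 < p.1 z) ∧ p.2.IsHermitian ∧
      ∀ z : Circle, ((G z)ᴴ * p.2 * G z).PosDef}) :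
    ∃ Df : C(Circle, ℝ) × Matrix (Fin n) (Fin n) ℂ →
        (C(Circle, ℝ) × Matrix (Fin n) (Fin n) ℂ →L[ℝ] Matrix (Fin n) (Fin n) ℂ),
      ContinuousOn Df D ∧
      ∀ p ∈ D, HasFDerivAt (momentMap G) (Df p) p ∧
        ∀ (δψ : C(Circle, ℝ)) (δΛ : Matrix (Fin n) (Fin n) ℂ),
          Df p (δψ, δΛ) = (2 * π)⁻¹ • ∫ θ in (-π)..π,
            (δψ (Circle.exp θ) •
                (G (Circle.exp θ) * ((G (Circle.exp θ))ᴴ * p.2 * G (Circle.exp θ))⁻¹ *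
                  (G (Circle.exp θ))ᴴ)
              - p.1 (Circle.exp θ) •
                (G (Circle.exp θ) * ((G (Circle.exp θ))ᴴ * p.2 * G (Circle.exp θ))⁻¹ *
                  ((G (Circle.exp θ))ᴴ * δΛ * G (Circle.exp θ)) *
                  ((G (Circle.exp θ))ᴴ * p.2 * G (Circle.exp θ))⁻¹ * (G (Circle.exp θ))ᴴ)) := by
  have hU : ∀ p ∈ D, IsUnit (Phimap G p.2) := by
    intro p hp
    rw [hD] at hp
    exact isUnit_of _ fun z => (hp.2.2 z).isUnit
  obtain ⟨Df, h1, h2⟩ := main_aux n m G D hU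
  refine ⟨Df, h1, fun p hp => ⟨(h2 p hp).1, fun a b => ?_⟩⟩
  rw [(h2 p hp).2 a b]
  simp only [Lmap, ContinuousLinearMap.coe_mk', LinearMap.coe_mk, AddHom.coe_mk,
      ContinuousMap.mul_apply, ContinuousMap.sub_apply, invC_apply _ (hU p hp)]
  simp [Emap, Phimap, Matrix.mul_sub, Matrix.sub_mul, Matrix.mul_assoc]
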